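/- arXiv:2405.15785 — 2 statements merged into one kernel-verified Lean document; each statement's English description precedes it below -/
import Mathlib

section
/- Let (J, ·, α, ω) be a cosymplectic Jacobi–Jordan algebra with Reeb vector ξ, and let Ψ : J → J*, Ψ(x) = ω(x,·) + α(x)α, be the associated linear isomorphism. Define the product * on J by Ψ(x*y)(z) = Ψ(x)(y·z) for all x, y, z ∈ J. Then: (1) for all x, y ∈ ker(α), x*y = x⊙y + ω(x, y·ξ)ξ, where ⊙ is the product on h = ker(α) determined by ω(x⊙y,z) = ω(x, y·z) for z ∈ h; (2) for all x ∈ J, x*ξ = x·ξ and ξ*x = 0; (3) (J,*) is right-skew-symmetric, i.e. (x,y,z)^* + (x,z,y)^* = 0 for all x, y, z ∈ J, where (x,y,z)^* = x*(y*z) + (x*y)*z; moreover x·y = x*y + y*x for all x, y. -/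
/-- Evaluation of the wedge product `α ∧ ωⁿ` of a 1-form `α` and a 2-form `ω` on a tuple of
`2n+1` vectors, via the normalized (characteristic-free, "shuffle/matching") formula:
the sum ranges over canonical representatives of the decompositions of `{0,…,2n}` into a
singleton (fed to `α`) and `n` ordered pairs (fed to `ω`).  `α ∧ ωⁿ ≠ 0` is rendered as
`∃ v, wedgeEval K n α ω v ≠ 0`. -/
def wedgeEval (K : Type*) [Field K] {V : Type*} (n : ℕ)
    (α : V → K) (ω : V → V → K) (v : Fin (2*n+1) → V) : K :=
  ∑ σ ∈ Finset.filter
      (fun σ : Equiv.Perm (Fin (2*n+1)) =>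
        (∀ i : Fin n, σ ⟨2*(i:ℕ)+1, by have := i.2; omega⟩ < σ ⟨2*(i:ℕ)+2, by have := i.2; omega⟩) ∧
        (∀ i j : Fin n, i < j →
          σ ⟨2*(i:ℕ)+1, by have := i.2; omega⟩ < σ ⟨2*(j:ℕ)+1, by have := j.2; omega⟩))
      Finset.univ,
    (Equiv.Perm.sign σ : ℤ) •
      (α (v (σ ⟨0, by omega⟩)) *
        ∏ i : Fin n,
          ω (v (σ ⟨2*(i:ℕ)+1, by have := i.2; omega⟩)) (v (σ ⟨2*(i:ℕ)+2, by have := i.2; omega⟩)))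

namespace Cosymplectic

/-- The first slot of the `i`-th pair. -/
def fstSlot {n : ℕ} (i : Fin n) : Fin (2*n+1) := ⟨2*(i:ℕ)+1, by have := i.2; omega⟩

/-- The second slot of the `i`-th pair. -/
def sndSlot {n : ℕ} (i : Fin n) : Fin (2*n+1) := ⟨2*(i:ℕ)+2, by have := i.2; omega⟩

lemma slot_cases {n : ℕ} (k : Fin (2*n+1)) :
    k = 0 ∨ (∃ i : Fin n, k = fstSlot i) ∨ ∃ i : Fin n, k = sndSlot i := by
  have hk := k.2
  rcases Nat.even_or_odd' (k : ℕ) with ⟨c, hc | hc⟩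
  · rcases Nat.eq_zero_or_pos c with h0 | h0
    · exact Or.inl (Fin.ext (by simp [hc, h0]))
    · exact Or.inr (Or.inr ⟨⟨c - 1, by omega⟩, Fin.ext (by simp only [sndSlot]; omega)⟩)
  · exact Or.inr (Or.inl ⟨⟨c, by omega⟩, Fin.ext (by simp only [fstSlot]; omega)⟩)

@[simp] lemma fstSlot_inj {n : ℕ} {i j : Fin n} : fstSlot i = fstSlot j ↔ i = j := by
  simp only [fstSlot, Fin.ext_iff]; omega

@[simp] lemma sndSlot_inj {n : ℕ} {i j : Fin n} : sndSlot i = sndSlot j ↔ i = j := by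
  simp only [sndSlot, Fin.ext_iff]; omega

@[simp] lemma fstSlot_ne_sndSlot {n : ℕ} (i j : Fin n) : fstSlot i ≠ sndSlot j := by
  simp only [fstSlot, sndSlot, ne_eq, Fin.ext_iff]; omega

@[simp] lemma sndSlot_ne_fstSlot {n : ℕ} (i j : Fin n) : sndSlot i ≠ fstSlot j :=
  (fstSlot_ne_sndSlot j i).symm

@[simp] lemma fstSlot_ne_zero {n : ℕ} (i : Fin n) : fstSlot i ≠ 0 := by
  simp [fstSlot, Fin.ext_iff]

@[simp] lemma sndSlot_ne_zero {n : ℕ} (i : Fin n) : sndSlot i ≠ 0 := by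
  simp [sndSlot, Fin.ext_iff]

@[simp] lemma zero_ne_fstSlot {n : ℕ} (i : Fin n) : 0 ≠ fstSlot i := (fstSlot_ne_zero i).symm

@[simp] lemma zero_ne_sndSlot {n : ℕ} (i : Fin n) : 0 ≠ sndSlot i := (sndSlot_ne_zero i).symm

/-- There is a permutation fixing `0` and exchanging the two slots of every pair. -/
lemma exists_pairing (n : ℕ) : ∃ ρ : Equiv.Perm (Fin (2*n+1)),
    ρ 0 = 0 ∧ (∀ i : Fin n, ρ (fstSlot i) = sndSlot i) ∧
      ∀ i : Fin n, ρ (sndSlot i) = fstSlot i := by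
  let g : Fin (2*n+1) → Fin (2*n+1) := fun k =>
    if h0 : (k : ℕ) = 0 then k else
      if h1 : (k : ℕ) % 2 = 1 then ⟨k + 1, by have := k.2; omega⟩
      else ⟨k - 1, by have := k.2; omega⟩
  have g0 : g 0 = 0 := by simp [g]
  have g1 (i : Fin n) : g (fstSlot i) = sndSlot i := by
    simp [g, fstSlot, sndSlot]
  have g2 (i : Fin n) : g (sndSlot i) = fstSlot i := by
    simp [g, fstSlot, sndSlot]
  have hg : Function.Involutive g := by
    intro k
    rcases slot_cases k with rfl | ⟨i, rfl⟩ | ⟨i, rfl⟩ <;> simp [g0, g1, g2]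
  exact ⟨hg.toPerm, g0, g1, g2⟩

/-- Slots of each pair are increasing, and pairs are sorted by their first slot. -/
def IsCanonical {n : ℕ} (σ : Equiv.Perm (Fin (2*n+1))) : Prop :=
  (∀ i : Fin n, σ (fstSlot i) < σ (sndSlot i)) ∧
    ∀ i j : Fin n, i < j → σ (fstSlot i) < σ (fstSlot j)

lemma IsCanonical.eq_of_conj_eq {n : ℕ} {ρ : Equiv.Perm (Fin (2*n+1))} (h0 : ρ 0 = 0)
    (h1 : ∀ i : Fin n, ρ (fstSlot i) = sndSlot i) (h2 : ∀ i : Fin n, ρ (sndSlot i) = fstSlot i)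
    {c d : Equiv.Perm (Fin (2*n+1))} (hc : IsCanonical c) (hd : IsCanonical d)
    (hcd : c * ρ * c⁻¹ = d * ρ * d⁻¹) : c = d := by
  obtain ⟨h, rfl⟩ : ∃ h, d = c * h := ⟨c⁻¹ * d, by simp⟩
  have hρ : ρ * h = h * ρ := by
    have : ρ = h * ρ * h⁻¹ := by
      apply mul_left_cancel (a := c)
      apply mul_right_cancel (b := c⁻¹)
      rw [hcd, mul_inv_rev]
      simp only [mul_assoc]
    nth_rewrite 1 [this]
    simp
  have hρ' (k) : ρ (h k) = h (ρ k) := DFunLike.congr_fun hρ k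
  have hfst (i : Fin n) : ∃ j : Fin n, h (fstSlot i) = fstSlot j := by
    have hlt : c (h (fstSlot i)) < c (ρ (h (fstSlot i))) := by
      rw [hρ', h1]; exact hd.1 i
    rcases slot_cases (h (fstSlot i)) with hk | ⟨j, hk⟩ | ⟨j, hk⟩
    · rw [hk, h0] at hlt
      exact absurd hlt (lt_irrefl _)
    · exact ⟨j, hk⟩
    · rw [hk, h2] at hlt
      exact absurd hlt (hc.1 j).asymm
  choose π hπ using hfst
  have hmono : StrictMono fun i : Fin n => c (fstSlot i) := fun i j hij => hc.2 i j hij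
  have hπmono : StrictMono π := fun i j hij => by
    have := hd.2 i j hij
    rw [Equiv.Perm.mul_apply, Equiv.Perm.mul_apply, hπ, hπ] at this
    exact hmono.lt_iff_lt.1 this
  have hπid : π = id := hπmono.eq_id
  have e1 (i : Fin n) : h (fstSlot i) = fstSlot i := by rw [hπ, hπid, id]
  have e2 (i : Fin n) : h (sndSlot i) = sndSlot i := by rw [← h1, ← hρ', e1]
  have e0 : h 0 = 0 := by
    have := hρ' 0
    rw [h0] at this
    rcases slot_cases (h 0) with hk | ⟨j, hk⟩ | ⟨j, hk⟩
    · exact hk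
    · simp [hk, h1] at this
    · simp [hk, h2] at this
  have : h = 1 := by
    ext1 k
    rcases slot_cases k with rfl | ⟨i, rfl⟩ | ⟨i, rfl⟩ <;> simp [e0, e1, e2]
  rw [this, mul_one]

section WedgeTerm

variable {K V : Type*} [Field K] [AddCommGroup V] [Module K V] {n : ℕ}
  (α : V →ₗ[K] K) (ω : V →ₗ[K] V →ₗ[K] K)

/-- The summand of `wedgeEval` indexed by `σ`. -/
def wedgeTerm (v : Fin (2*n+1) → V) (σ : Equiv.Perm (Fin (2*n+1))) : K :=
  (Equiv.Perm.sign σ : ℤ) •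
    (α (v (σ 0)) * ∏ i : Fin n, ω (v (σ (fstSlot i))) (v (σ (sndSlot i))))

open Classical in
lemma wedgeEval_eq (v : Fin (2*n+1) → V) :
    wedgeEval K n (fun x => α x) (fun x y => ω x y) v =
      ∑ σ with IsCanonical σ, wedgeTerm α ω v σ := by
  unfold wedgeEval
  refine Finset.sum_congr ?_ fun _ _ => rfl
  ext σ
  simp only [Finset.mem_filter]
  rfl

lemma wedgeTerm_mul_swap_slots (halt : ∀ x, ω x x = 0) (v : Fin (2*n+1) → V)
    (σ : Equiv.Perm (Fin (2*n+1))) (i : Fin n) :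
    wedgeTerm α ω v (σ * Equiv.swap (fstSlot i) (sndSlot i)) = wedgeTerm α ω v σ := by
  have hanti (x y) : ω x y = -ω y x := (LinearMap.IsAlt.neg (B := ω) halt y x).symm
  have hprod : ∏ k : Fin n, ω (v ((σ * Equiv.swap (fstSlot i) (sndSlot i)) (fstSlot k)))
        (v ((σ * Equiv.swap (fstSlot i) (sndSlot i)) (sndSlot k))) =
      ∏ k : Fin n, (if k = i then -1 else 1) * ω (v (σ (fstSlot k))) (v (σ (sndSlot k))) := by
    refine Finset.prod_congr rfl fun k _ => ?_
    by_cases hk : k = i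
    · subst hk
      simp [← hanti]
    · simp [hk, Equiv.swap_apply_of_ne_of_ne]
  unfold wedgeTerm
  rw [hprod, Finset.prod_mul_distrib]
  simp [Equiv.swap_apply_of_ne_of_ne]

/-- The permutation exchanging the `i`-th and the `j`-th pair. -/
def swapPairs (i j : Fin n) : Equiv.Perm (Fin (2*n+1)) :=
  Equiv.swap (fstSlot i) (fstSlot j) * Equiv.swap (sndSlot i) (sndSlot j)

lemma swapPairs_zero (i j : Fin n) : swapPairs i j 0 = 0 := by
  simp [swapPairs, Equiv.swap_apply_of_ne_of_ne]

lemma swapPairs_fstSlot (i j k : Fin n) :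
    swapPairs i j (fstSlot k) = fstSlot (Equiv.swap i j k) := by
  simp only [swapPairs, Equiv.Perm.mul_apply, Equiv.swap_apply_def, fstSlot_inj,
    fstSlot_ne_sndSlot, if_false]
  split_ifs <;> rfl

lemma swapPairs_sndSlot (i j k : Fin n) :
    swapPairs i j (sndSlot k) = sndSlot (Equiv.swap i j k) := by
  simp only [swapPairs, Equiv.Perm.mul_apply, Equiv.swap_apply_def, sndSlot_inj]
  split_ifs <;> simp_all

lemma wedgeTerm_mul_swapPairs (v : Fin (2*n+1) → V)
    (σ : Equiv.Perm (Fin (2*n+1))) {i j : Fin n} (hij : i ≠ j) :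
    wedgeTerm α ω v (σ * swapPairs i j) = wedgeTerm α ω v σ := by
  have hsign : Equiv.Perm.sign (swapPairs i j) = 1 := by
    simp [swapPairs, hij]
  unfold wedgeTerm
  simp only [Equiv.Perm.mul_apply, swapPairs_zero, swapPairs_fstSlot, swapPairs_sndSlot,
    Equiv.Perm.sign_mul, hsign, mul_one]
  rw [Equiv.prod_comp (Equiv.swap i j)
    (fun k => ω (v (σ (fstSlot k))) (v (σ (sndSlot k))))]

lemma exists_isCanonical (halt : ∀ x, ω x x = 0) {ρ : Equiv.Perm (Fin (2*n+1))} (h0 : ρ 0 = 0)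
    (h1 : ∀ i : Fin n, ρ (fstSlot i) = sndSlot i) (h2 : ∀ i : Fin n, ρ (sndSlot i) = fstSlot i)
    (v : Fin (2*n+1) → V) (σ : Equiv.Perm (Fin (2*n+1))) :
    ∃ c, IsCanonical c ∧ c * ρ * c⁻¹ = σ * ρ * σ⁻¹ ∧
      wedgeTerm α ω v c = wedgeTerm α ω v σ := by
  classical
  obtain ⟨c, hcmem, hmin⟩ := Finset.exists_min_image
    ({c | c * ρ * c⁻¹ = σ * ρ * σ⁻¹ ∧ wedgeTerm α ω v c = wedgeTerm α ω v σ} :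
      Finset (Equiv.Perm (Fin (2*n+1))))
    (fun c => toLex fun i : Fin n => c (fstSlot i)) ⟨σ, by simp⟩
  simp only [Finset.mem_filter, Finset.mem_univ, true_and] at hcmem hmin
  obtain ⟨hconj, hterm⟩ := hcmem
  have key (h : Equiv.Perm (Fin (2*n+1))) (hcomm : h * ρ = ρ * h)
      (ht : wedgeTerm α ω v (c * h) = wedgeTerm α ω v c) (i : Fin n)
      (hlt : ∀ j < i, h (fstSlot j) = fstSlot j) : c (fstSlot i) ≤ c (h (fstSlot i)) := by
    by_contra! hi
    refine absurd (hmin (c * h) ⟨?_, ht.trans hterm⟩) (not_le.2 ⟨i, fun j hj => ?_, hi⟩)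
    · rw [← hconj, mul_inv_rev, mul_assoc c h, hcomm]
      simp [mul_assoc]
    · simp [hlt j hj]
  refine ⟨c, ⟨fun i => ?_, fun i j hij => ?_⟩, hconj, hterm⟩
  · have := key (Equiv.swap (fstSlot i) (sndSlot i)) (by
      rw [Equiv.mul_swap_eq_swap_mul, h1, h2, Equiv.swap_comm])
      (wedgeTerm_mul_swap_slots α ω halt v c i) i
      (fun j hj => by simp [Equiv.swap_apply_of_ne_of_ne, hj.ne])
    rw [Equiv.swap_apply_left] at this
    exact lt_of_le_of_ne this (c.injective.ne (fstSlot_ne_sndSlot i i))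
  · have := key (swapPairs i j) (by
      ext1 k
      rcases slot_cases k with rfl | ⟨l, rfl⟩ | ⟨l, rfl⟩ <;>
        simp [h0, h1, h2, swapPairs_zero, swapPairs_fstSlot, swapPairs_sndSlot])
      (wedgeTerm_mul_swapPairs α ω v c hij.ne) i
      (fun k hk => by
        rw [swapPairs_fstSlot, Equiv.swap_apply_of_ne_of_ne hk.ne (hk.trans hij).ne])
    rw [swapPairs_fstSlot, Equiv.swap_apply_left] at this
    exact lt_of_le_of_ne this (c.injective.ne (by simpa using hij.ne))

lemma wedgeTerm_swap_mul {v : Fin (2*n+1) → V} {i j : Fin (2*n+1)} (hv : v i = v j)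
    (hij : i ≠ j) (σ : Equiv.Perm (Fin (2*n+1))) :
    wedgeTerm α ω v (Equiv.swap i j * σ) = -wedgeTerm α ω v σ := by
  have hswap (k) : v (Equiv.swap i j k) = v k := by
    rw [Equiv.swap_apply_def]
    split_ifs with h h' <;> simp_all
  simp [wedgeTerm, hswap, Equiv.Perm.sign_swap hij]

lemma wedgeEval_eq_zero_of_eq (htwo : (2 : K) ≠ 0) (halt : ∀ x, ω x x = 0)
    {v : Fin (2*n+1) → V} {i j : Fin (2*n+1)} (hv : v i = v j) (hij : i ≠ j) :
    wedgeEval K n (fun x => α x) (fun x y => ω x y) v = 0 := by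
  classical
  obtain ⟨ρ, h0, h1, h2⟩ := exists_pairing n
  choose g hg using fun σ => exists_isCanonical α ω halt h0 h1 h2 v (Equiv.swap i j * σ)
  have hterm (σ) : wedgeTerm α ω v (g σ) = -wedgeTerm α ω v σ :=
    (hg σ).2.2.trans (wedgeTerm_swap_mul α ω hv hij σ)
  have hconj (σ) : g σ * ρ * (g σ)⁻¹ = Equiv.swap i j * (σ * ρ * σ⁻¹) * Equiv.swap i j := by
    rw [(hg σ).2.1]
    simp [mul_assoc]
  rw [wedgeEval_eq]
  refine Finset.sum_involution (fun σ _ => g σ) (fun σ _ => by simp [hterm])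
    (fun σ _ hne heq => hne ?_) (fun σ _ => by simp [(hg σ).1]) (fun σ hσ => ?_)
  · have := hterm σ
    rw [heq, eq_neg_iff_add_eq_zero, ← two_mul] at this
    exact (mul_eq_zero.1 this).resolve_left htwo
  · refine (hg _).1.eq_of_conj_eq h0 h1 h2 (Finset.mem_filter.1 hσ).2 ?_
    rw [hconj, hconj]
    simp [← mul_assoc]

lemma wedgeTerm_eq_zero (halt : ∀ x, ω x x = 0) {u : V} (hα : α u = 0) (hω : ∀ z, ω u z = 0)
    {v : Fin (2*n+1) → V} {k : Fin (2*n+1)} (hk : v k = u) (σ : Equiv.Perm (Fin (2*n+1))) :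
    wedgeTerm α ω v σ = 0 := by
  have hω' (z) : ω z u = 0 := by
    rw [← LinearMap.IsAlt.neg (B := ω) halt, hω, neg_zero]
  obtain ⟨l, rfl⟩ := σ.surjective k
  unfold wedgeTerm
  rcases slot_cases l with rfl | ⟨i, rfl⟩ | ⟨i, rfl⟩
  · simp [hk, hα]
  · rw [Finset.prod_eq_zero (Finset.mem_univ i) (by rw [hk, hω])]; simp
  · rw [Finset.prod_eq_zero (Finset.mem_univ i) (by rw [hk, hω'])]; simp

lemma exists_linearMap_wedgeTerm_update (v : Fin (2*n+1) → V) (k : Fin (2*n+1))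
    (σ : Equiv.Perm (Fin (2*n+1))) :
    ∃ L : V →ₗ[K] K, ∀ w, wedgeTerm α ω (Function.update v k w) σ = L w := by
  obtain ⟨l, rfl⟩ := σ.surjective k
  have hne {l l' : Fin (2*n+1)} (h : l' ≠ l) (w : V) :
      Function.update v (σ l) w (σ l') = v (σ l') :=
    Function.update_of_ne (σ.injective.ne h) _ _
  unfold wedgeTerm
  rcases slot_cases l with rfl | ⟨i, rfl⟩ | ⟨i, rfl⟩
  · refine ⟨((Equiv.Perm.sign σ : ℤ) : K) •
      (∏ i : Fin n, ω (v (σ (fstSlot i))) (v (σ (sndSlot i)))) • α, fun w => ?_⟩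
    simp [mul_comm]
  · refine ⟨((Equiv.Perm.sign σ : ℤ) : K) • (α (v (σ 0)) *
      ∏ j ∈ {i}ᶜ, ω (v (σ (fstSlot j))) (v (σ (sndSlot j)))) • ω.flip (v (σ (sndSlot i))),
      fun w => ?_⟩
    rw [Fintype.prod_eq_mul_prod_compl i, Finset.prod_congr rfl fun j hj => by
      rw [hne (by simpa using hj), hne (by simp)]]
    simp only [Function.update_self, hne (sndSlot_ne_fstSlot _ _), hne (zero_ne_fstSlot _),
      LinearMap.smul_apply, LinearMap.flip_apply, zsmul_eq_mul, smul_eq_mul]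
    ring
  · refine ⟨((Equiv.Perm.sign σ : ℤ) : K) • (α (v (σ 0)) *
      ∏ j ∈ {i}ᶜ, ω (v (σ (fstSlot j))) (v (σ (sndSlot j)))) • ω (v (σ (fstSlot i))),
      fun w => ?_⟩
    rw [Fintype.prod_eq_mul_prod_compl i, Finset.prod_congr rfl fun j hj => by
      rw [hne (l' := sndSlot j) (by simpa using hj), hne (by simp)]]
    simp only [Function.update_self, hne (fstSlot_ne_sndSlot _ _), hne (zero_ne_sndSlot _),
      LinearMap.smul_apply, zsmul_eq_mul, smul_eq_mul]
    ring

lemma exists_linearMap_wedgeEval_update (v : Fin (2*n+1) → V) (k : Fin (2*n+1)) :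
    ∃ L : V →ₗ[K] K, ∀ w,
      wedgeEval K n (fun x => α x) (fun x y => ω x y) (Function.update v k w) = L w := by
  classical
  choose L hL using exists_linearMap_wedgeTerm_update α ω v k
  exact ⟨∑ σ with IsCanonical σ, L σ, fun w => by simp [wedgeEval_eq, hL]⟩

/-- `α ∧ ωⁿ` as an alternating map. -/
def wedgeAlternating (htwo : (2 : K) ≠ 0) (halt : ∀ x, ω x x = 0) :
    V [⋀^Fin (2*n+1)]→ₗ[K] K where
  toFun := wedgeEval K n (fun x => α x) (fun x y => ω x y)
  map_update_add' v k x y := by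
    obtain ⟨L, hL⟩ := exists_linearMap_wedgeEval_update α ω v k
    convert L.map_add x y <;> rw [← hL] <;> congr!
  map_update_smul' v k c x := by
    obtain ⟨L, hL⟩ := exists_linearMap_wedgeEval_update α ω v k
    convert L.map_smul c x <;> rw [← hL] <;> congr!
  map_eq_zero_of_eq' _ _ _ hv hij := wedgeEval_eq_zero_of_eq α ω htwo halt hv hij

/-- If `α ∧ ωⁿ ≠ 0` in dimension `2n+1`, then `ker α` and the radical of `ω` meet trivially. -/
lemma eq_zero_of_mem_radical [FiniteDimensional K V] (htwo : (2 : K) ≠ 0)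
    (hrank : Module.finrank K V = 2*n+1) (halt : ∀ x, ω x x = 0)
    (hwedge : ∃ v, wedgeEval K n (fun x => α x) (fun x y => ω x y) v ≠ 0)
    {u : V} (hα : α u = 0) (hω : ∀ z, ω u z = 0) : u = 0 := by
  by_contra hu
  obtain ⟨v, hv⟩ := hwedge
  have hli : LinearIndepOn K id ({u} : Set V) := by
    simpa using LinearIndepOn.singleton (R := K) (v := id) (i := u) hu
  let b := Module.Basis.extend hli
  have : Fintype (hli.extend (Set.subset_univ _)) := FiniteDimensional.fintypeBasisIndex b
  let e : hli.extend (Set.subset_univ _) ≃ Fin (2*n+1) :=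
    Fintype.equivFinOfCardEq (by rw [← hrank, Module.finrank_eq_card_basis b])
  let b' := b.reindex e
  obtain ⟨l, hl⟩ : ∃ l, b' l = u :=
    ⟨e ⟨u, hli.subset_extend _ rfl⟩, by simp [b', b]⟩
  have hzero : wedgeAlternating (n := n) α ω htwo halt = 0 := by
    refine Module.Basis.ext_alternating b' fun s hs => ?_
    obtain ⟨k, rfl⟩ := Finite.surjective_of_injective hs l
    change wedgeEval K n (fun x => α x) (fun x y => ω x y) (fun i => b' (s i)) = 0
    rw [wedgeEval_eq]
    exact Finset.sum_eq_zero fun σ _ => wedgeTerm_eq_zero α ω halt hα hω (k := k) hl σ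
  exact hv (DFunLike.congr_fun hzero v)

end WedgeTerm

end Cosymplectic

/-- Let `(J,·,α,ω)` be a cosymplectic JJ-algebra with Reeb vector `ξ` and
`Ψ(x) = ω(x,·) + α(x)α` the associated isomorphism.  Let `*` be the product defined by
`Ψ(x*y)(z) = Ψ(x)(y·z)`, and `⊙` the product on `h = ker α` with `ω(x⊙y,z) = ω(x,y·z)`
for `z ∈ h`.  Then (1) `x*y = x⊙y + ω(x, y·ξ)ξ` on `h`; (2) `x*ξ = x·ξ` and `ξ*x = 0`;
(3) `(J,*)` is right-skew-symmetric; moreover `x·y = x*y + y*x`. -/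
theorem stmt10 {K V : Type*} [Field K] [AddCommGroup V] [Module K V]
    [FiniteDimensional K V] (h2 : (2 : K) ≠ 0) (h3 : (3 : K) ≠ 0)
    (n : ℕ) (hrank : Module.finrank K V = 2*n+1)
    (m : V →ₗ[K] V →ₗ[K] V)
    (hcomm : ∀ x y, m x y = m y x)
    (hjac : ∀ x y z, m x (m y z) + m y (m z x) + m z (m x y) = 0)
    (α : V →ₗ[K] K) (ω : V →ₗ[K] V →ₗ[K] K)
    (halt : ∀ x, ω x x = 0)
    (hwedge : ∃ v, wedgeEval K n (fun x => α x) (fun x y => ω x y) v ≠ 0)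
    (hαcl : ∀ x y, α (m x y) = 0)
    (hωcl : ∀ x y z, ω (m x y) z + ω (m z x) y + ω (m y z) x = 0)
    (ξ : V) (hξ1 : α ξ = 1) (hξ0 : ∀ y, ω ξ y = 0)
    (odot : V → V → V)
    (hodotmem : ∀ x y, α x = 0 → α y = 0 → α (odot x y) = 0)
    (hodot : ∀ x y z, α x = 0 → α y = 0 → α z = 0 → ω (odot x y) z = ω x (m y z))
    (star : V → V → V)
    (hstar : ∀ x y z : V,
      ω (star x y) z + α (star x y) * α z = ω x (m y z) + α x * α (m y z))
    : (∀ x y, α x = 0 → α y = 0 → star x y = odot x y + ω x (m y ξ) • ξ) ∧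
      (∀ x : V, star x ξ = m x ξ) ∧
      (∀ x : V, star ξ x = 0) ∧
      (∀ x y z : V,
        (star x (star y z) + star (star x y) z) +
          (star x (star z y) + star (star x z) y) = 0) ∧
      (∀ x y : V, m x y = star x y + star y x) := by
  have hanti (x y) : ω x y = -ω y x := (LinearMap.IsAlt.neg (B := ω) halt y x).symm
  have hωξ (x) : ω x ξ = 0 := by rw [hanti, hξ0, neg_zero]
  have hext {x y : V} (h : ∀ z, ω x z + α x * α z = ω y z + α y * α z) : x = y := by
    have hα : α x = α y := by simpa [hωξ, hξ1] using h ξ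
    refine sub_eq_zero.1 (Cosymplectic.eq_zero_of_mem_radical α ω h2 hrank halt hwedge
      (by simp [hα]) fun z => ?_)
    simpa [hα, sub_eq_zero] using h z
  have hstar' (x y z) : ω (star x y) z + α (star x y) * α z = ω x (m y z) := by
    simp [hstar, hαcl]
  have hαstar (x y) : α (star x y) = ω x (m y ξ) := by
    simpa [hωξ, hξ1] using hstar' x y ξ
  have hsum (x y) : m x y = star x y + star y x := hext fun z => by
    have := hωcl x y z
    simp only [map_add, LinearMap.add_apply, hαcl]
    linear_combination this - hstar' x y z - hstar' y x z - hanti x (m y z) - hanti y (m x z)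
      + congrArg (ω · y) (hcomm x z)
  refine ⟨fun x y hx hy => hext fun z => ?_, fun x => hext fun z => ?_, fun x => hext fun z => ?_,
    fun x y z => hext fun w => ?_, hsum⟩
  · have hz := hodot x y (z - α z • ξ) hx hy (by simp [hξ1])
    simp only [map_sub, map_smul, hωξ, smul_eq_mul, mul_zero, sub_zero] at hz
    simp only [hstar', map_add, map_smul, LinearMap.add_apply, LinearMap.smul_apply, hξ0, hξ1,
      smul_eq_mul, hodotmem x y hx hy]
    linear_combination -hz
  · rw [hstar', hαcl]
    linear_combination -hωcl x ξ z + hωξ (m z x) + hanti x (m ξ z)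
  · simp [hstar', hξ0]
  · have h (x y z) : ω (star (star x y) z) w + α (star (star x y) z) * α w
        = ω x (m y (m z w)) := by
      rw [hstar', ← hstar' x y (m z w), hαcl]
      ring
    have hJ : m (star y z) w + m (star z y) w + m y (m z w) + m z (m y w) = 0 := by
      rw [← LinearMap.add_apply, ← map_add, ← hsum, hcomm _ w, hcomm y w, ← hjac w y z]
    have hJ' := congrArg (ω x) hJ
    simp only [map_add, map_zero] at hJ'
    simp only [map_add, LinearMap.add_apply, map_zero, LinearMap.zero_apply]
    linear_combination hJ' + hstar' x (star y z) w + hstar' x (star z y) w + h x y z + h x z y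
end

section
/- Let (J, ·, α, ω) be a cosymplectic Jacobi–Jordan algebra of dimension 2n+1 with Reeb vector ξ. Then h = ker(α) with ω_h = ω|_{h×h} is a 2n-dimensional symplectic Jacobi–Jordan algebra, and the map D : h → h, D(x) = ξ·x, is an anti-derivation of (h,·) satisfying D² = 0 and ω_h(D(x), y) = ω_h(x, D(y)) for all x, y ∈ h. -/
/-- The first position of the `i`-th pair. -/
def pairFst {n : ℕ} (i : Fin n) : Fin (2*n+1) := ⟨2*(i:ℕ)+1, by have := i.2; omega⟩

/-- The second position of the `i`-th pair. -/
def pairSnd {n : ℕ} (i : Fin n) : Fin (2*n+1) := ⟨2*(i:ℕ)+2, by have := i.2; omega⟩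

section positions

variable {n : ℕ} {i j : Fin n}

@[simp] lemma pairFst_inj : pairFst i = pairFst j ↔ i = j := by
  simp only [pairFst, Fin.ext_iff]; omega

@[simp] lemma pairSnd_inj : pairSnd i = pairSnd j ↔ i = j := by
  simp only [pairSnd, Fin.ext_iff]; omega

@[simp] lemma pairFst_ne_pairSnd : pairFst i ≠ pairSnd j := by
  simp only [pairFst, pairSnd, ne_eq, Fin.ext_iff]; omega

@[simp] lemma pairSnd_ne_pairFst : pairSnd i ≠ pairFst j := pairFst_ne_pairSnd.symm

@[simp] lemma zero_ne_pairFst : 0 ≠ pairFst i := by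
  simp [pairFst, Fin.ext_iff]

@[simp] lemma zero_ne_pairSnd : 0 ≠ pairSnd i := by
  simp [pairSnd, Fin.ext_iff]

lemma eq_zero_or_pair (k : Fin (2*n+1)) :
    k = 0 ∨ (∃ i : Fin n, k = pairFst i) ∨ ∃ i : Fin n, k = pairSnd i := by
  have hk := k.2
  rcases Nat.eq_zero_or_pos (k : ℕ) with h | h
  · exact Or.inl (Fin.ext h)
  · rcases Nat.even_or_odd' (k : ℕ) with ⟨c, hc | hc⟩
    · exact Or.inr (Or.inr ⟨⟨c - 1, by omega⟩, Fin.ext (by simp only [pairSnd]; omega)⟩)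
    · exact Or.inr (Or.inl ⟨⟨c, by omega⟩, Fin.ext (by simp only [pairFst]; omega)⟩)

/-- Exchange the two positions of the `i`-th pair. -/
def pairFlip (i : Fin n) : Equiv.Perm (Fin (2*n+1)) := Equiv.swap (pairFst i) (pairSnd i)

/-- Exchange the `i`-th and the `j`-th pair. -/
def pairExchange (i j : Fin n) : Equiv.Perm (Fin (2*n+1)) :=
  Equiv.swap (pairFst i) (pairFst j) * Equiv.swap (pairSnd i) (pairSnd j)

lemma pairFlip_zero : pairFlip i 0 = 0 :=
  Equiv.swap_apply_of_ne_of_ne zero_ne_pairFst zero_ne_pairSnd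

lemma pairFlip_fst_self : pairFlip i (pairFst i) = pairSnd i := Equiv.swap_apply_left _ _

lemma pairFlip_snd_self : pairFlip i (pairSnd i) = pairFst i := Equiv.swap_apply_right _ _

lemma pairFlip_fst_of_ne (h : j ≠ i) : pairFlip i (pairFst j) = pairFst j :=
  Equiv.swap_apply_of_ne_of_ne (by simpa using h) (by simp)

lemma pairFlip_snd_of_ne (h : j ≠ i) : pairFlip i (pairSnd j) = pairSnd j :=
  Equiv.swap_apply_of_ne_of_ne (by simp) (by simpa using h)

lemma pairExchange_zero : pairExchange i j 0 = 0 := by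
  simp [pairExchange, Equiv.swap_apply_of_ne_of_ne]

lemma pairExchange_fst (k : Fin n) :
    pairExchange i j (pairFst k) = pairFst (Equiv.swap i j k) := by
  simp only [pairExchange, Equiv.Perm.mul_apply, Equiv.swap_apply_def, pairFst_inj,
    pairFst_ne_pairSnd, if_false]
  split_ifs <;> rfl

lemma pairExchange_snd (k : Fin n) :
    pairExchange i j (pairSnd k) = pairSnd (Equiv.swap i j k) := by
  simp only [pairExchange, Equiv.Perm.mul_apply, Equiv.swap_apply_def, pairSnd_inj, apply_ite pairSnd]
  split_ifs <;> simp_all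

variable (n) in
/-- The group of permutations that preserve the decomposition of the positions into the
singleton `{0}` and the `n` pairs. -/
def pairGroup : Subgroup (Equiv.Perm (Fin (2*n+1))) :=
  Subgroup.closure {h | (∃ i, h = pairFlip i) ∨ ∃ i j, i ≠ j ∧ h = pairExchange i j}

lemma pairFlip_mem (i : Fin n) : pairFlip i ∈ pairGroup n :=
  Subgroup.subset_closure (Or.inl ⟨i, rfl⟩)

lemma pairExchange_mem (h : i ≠ j) : pairExchange i j ∈ pairGroup n :=
  Subgroup.subset_closure (Or.inr ⟨i, j, h, rfl⟩)

lemma pairGroup_apply {h : Equiv.Perm (Fin (2*n+1))} (hh : h ∈ pairGroup n) :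
    h 0 = 0 ∧ ∀ i, ∃ j, (h (pairFst i) = pairFst j ∧ h (pairSnd i) = pairSnd j) ∨
      (h (pairFst i) = pairSnd j ∧ h (pairSnd i) = pairFst j) := by
  induction hh using Subgroup.closure_induction with
  | mem h hmem =>
    rcases hmem with ⟨i, rfl⟩ | ⟨i, j, -, rfl⟩
    · refine ⟨pairFlip_zero, fun k => ⟨k, ?_⟩⟩
      rcases eq_or_ne k i with rfl | hk
      · exact Or.inr ⟨pairFlip_fst_self, pairFlip_snd_self⟩
      · exact Or.inl ⟨pairFlip_fst_of_ne hk, pairFlip_snd_of_ne hk⟩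
    · exact ⟨pairExchange_zero, fun k => ⟨_, Or.inl ⟨pairExchange_fst k, pairExchange_snd k⟩⟩⟩
  | one => exact ⟨rfl, fun i => ⟨i, Or.inl ⟨rfl, rfl⟩⟩⟩
  | mul g h _ _ hg hh =>
    refine ⟨by simp [hg.1, hh.1], fun i => ?_⟩
    obtain ⟨j, hj⟩ := hh.2 i
    obtain ⟨k, hk⟩ := hg.2 j
    refine ⟨k, ?_⟩
    simp only [Equiv.Perm.mul_apply]
    rcases hj with ⟨h1, h2⟩ | ⟨h1, h2⟩ <;> rcases hk with ⟨h3, h4⟩ | ⟨h3, h4⟩ <;>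
      simp [h1, h2, h3, h4]
  | inv h _ hh =>
    refine ⟨by rw [Equiv.Perm.inv_eq_iff_eq, hh.1], fun i => ?_⟩
    simp only [Equiv.Perm.inv_eq_iff_eq]
    rcases eq_zero_or_pair (h⁻¹ (pairFst i)) with h0 | ⟨j, h0⟩ | ⟨j, h0⟩ <;>
      rw [Equiv.Perm.inv_eq_iff_eq] at h0
    · simp [hh.1] at h0
      exact absurd h0.symm zero_ne_pairFst
    · obtain ⟨k, ⟨h1, h2⟩ | ⟨h1, h2⟩⟩ := hh.2 j <;> rw [h1] at h0
      · obtain rfl := pairFst_inj.1 h0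
        exact ⟨j, Or.inl ⟨h1.symm, h2.symm⟩⟩
      · exact absurd h0 pairFst_ne_pairSnd
    · obtain ⟨k, ⟨h1, h2⟩ | ⟨h1, h2⟩⟩ := hh.2 j <;> rw [h2] at h0
      · exact absurd h0 pairFst_ne_pairSnd
      · obtain rfl := pairFst_inj.1 h0
        exact ⟨j, Or.inr ⟨h2.symm, h1.symm⟩⟩

/-- The permutations over which `wedgeEval` sums: each pair is increasing and the first
entries of the pairs increase. -/
def IsPairSorted (σ : Equiv.Perm (Fin (2*n+1))) : Prop :=
  (∀ i : Fin n, σ (pairFst i) < σ (pairSnd i)) ∧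
    ∀ i j : Fin n, i < j → σ (pairFst i) < σ (pairFst j)

lemma IsPairSorted.eq_one_of_mul {σ h : Equiv.Perm (Fin (2*n+1))} (hσ : IsPairSorted σ)
    (hσh : IsPairSorted (σ * h)) (hh : h ∈ pairGroup n) : h = 1 := by
  obtain ⟨h0, hp⟩ := pairGroup_apply hh
  have hp' : ∀ i, ∃ j, h (pairFst i) = pairFst j ∧ h (pairSnd i) = pairSnd j := fun i => by
    obtain ⟨j, hj | ⟨h1, h2⟩⟩ := hp i
    · exact ⟨j, hj⟩
    · have := hσh.1 i
      simp only [Equiv.Perm.mul_apply, h1, h2] at this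
      exact absurd this (hσ.1 j).asymm
  choose ρ hρ using hp'
  have hg : StrictMono fun i => σ (pairFst i) := fun i j => hσ.2 i j
  have hρm : StrictMono ρ := fun i j hij => by
    have := hσh.2 i j hij
    simp only [Equiv.Perm.mul_apply, (hρ _).1] at this
    exact hg.lt_iff_lt.1 this
  have hid : ∀ i, ρ i = i := fun i => le_antisymm hρm.apply_le hρm.le_apply
  ext k : 1
  rcases eq_zero_or_pair k with rfl | ⟨i, rfl⟩ | ⟨i, rfl⟩
  · exact h0
  · rw [(hρ i).1, hid]; rfl
  · rw [(hρ i).2, hid]; rfl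

/-- A weight that decreases when a permutation is brought closer to being pair-sorted. -/
def pairWeight (σ : Equiv.Perm (Fin (2*n+1))) : ℕ :=
  ∑ i : Fin n, (n - (i : ℕ)) * (σ (pairFst i) : ℕ)

lemma pairWeight_flip_lt {σ : Equiv.Perm (Fin (2*n+1))}
    (h : σ (pairSnd i) < σ (pairFst i)) : pairWeight (σ * pairFlip i) < pairWeight σ := by
  refine Finset.sum_lt_sum (fun k _ => ?_) ⟨i, Finset.mem_univ _, ?_⟩
  · rcases eq_or_ne k i with rfl | hk
    · rw [Equiv.Perm.mul_apply, pairFlip_fst_self]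
      exact Nat.mul_le_mul_left _ h.le
    · rw [Equiv.Perm.mul_apply, pairFlip_fst_of_ne hk]
  · rw [Equiv.Perm.mul_apply, pairFlip_fst_self]
    exact Nat.mul_lt_mul_of_pos_left h (by have := i.2; omega)

lemma pairWeight_exchange_lt {σ : Equiv.Perm (Fin (2*n+1))} (hij : i < j)
    (h : σ (pairFst j) < σ (pairFst i)) : pairWeight (σ * pairExchange i j) < pairWeight σ := by
  simp only [pairWeight, Equiv.Perm.mul_apply, pairExchange_fst]
  rw [← Finset.add_sum_erase _ _ (Finset.mem_univ i),
    ← Finset.add_sum_erase _ (fun k : Fin n => (n - (k : ℕ)) * (σ (pairFst k) : ℕ))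
      (Finset.mem_univ i),
    ← Finset.add_sum_erase _ _ (Finset.mem_erase.2 ⟨hij.ne', Finset.mem_univ j⟩),
    ← Finset.add_sum_erase _ (fun k : Fin n => (n - (k : ℕ)) * (σ (pairFst k) : ℕ))
      (Finset.mem_erase.2 ⟨hij.ne', Finset.mem_univ j⟩)]
  have hrest : ∀ k ∈ (Finset.univ.erase i).erase j,
      (n - (k : ℕ)) * (σ (pairFst (Equiv.swap i j k)) : ℕ) = (n - (k : ℕ)) * σ (pairFst k) := by
    intro k hk
    simp only [Finset.mem_erase] at hk
    rw [Equiv.swap_apply_of_ne_of_ne hk.2.1 hk.1]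
  rw [Finset.sum_congr rfl hrest, Equiv.swap_apply_left, Equiv.swap_apply_right]
  obtain ⟨a, ha⟩ := Nat.exists_eq_add_of_lt (Fin.lt_def.1 h)
  obtain ⟨b, hb⟩ : ∃ b, n - (i : ℕ) = (n - (j : ℕ)) + b + 1 :=
    ⟨(j : ℕ) - i - 1, by have := j.2; have := Fin.lt_def.1 hij; omega⟩
  rw [ha, hb]
  nlinarith [Nat.zero_le (a * b)]

lemma exists_isPairSorted_mul (σ : Equiv.Perm (Fin (2*n+1))) :
    ∃ h ∈ pairGroup n, IsPairSorted (σ * h) := by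
  induction hw : pairWeight σ using Nat.strong_induction_on generalizing σ with
  | _ w ih =>
    subst hw
    have step : ∀ g ∈ pairGroup n, pairWeight (σ * g) < pairWeight σ →
        ∃ h ∈ pairGroup n, IsPairSorted (σ * h) := fun g hg hlt => by
      obtain ⟨h, hh, hs⟩ := ih _ hlt (σ * g) rfl
      exact ⟨g * h, mul_mem hg hh, by rwa [← mul_assoc]⟩
    by_cases h1 : ∀ i : Fin n, σ (pairFst i) < σ (pairSnd i)
    · by_cases h2 : ∀ i j : Fin n, i < j → σ (pairFst i) < σ (pairFst j)
      · exact ⟨1, one_mem _, by rw [mul_one]; exact ⟨h1, h2⟩⟩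
      · push Not at h2
        obtain ⟨i, j, hij, hle⟩ := h2
        refine step _ (pairExchange_mem hij.ne) (pairWeight_exchange_lt hij (hle.lt_of_ne ?_))
        simpa using hij.ne'
    · push Not at h1
      obtain ⟨i, hle⟩ := h1
      refine step _ (pairFlip_mem i) (pairWeight_flip_lt (hle.lt_of_ne ?_))
      simp

end positions

section wedge

variable {K V : Type*} [Field K] [AddCommGroup V] [Module K V] {n : ℕ}
  (α : V →ₗ[K] K) (ω : V →ₗ[K] V →ₗ[K] K)

/-- The contribution of the permutation `σ` to `wedgeEval`. -/
def wedgeTerm (v : Fin (2*n+1) → V) (σ : Equiv.Perm (Fin (2*n+1))) : K :=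
  (Equiv.Perm.sign σ : ℤ) •
    (α (v (σ 0)) * ∏ i : Fin n, ω (v (σ (pairFst i))) (v (σ (pairSnd i))))

open scoped Classical in
lemma wedgeEval_eq_sum_wedgeTerm (v : Fin (2*n+1) → V) :
    wedgeEval K n (fun x => α x) (fun x y => ω x y) v =
      ∑ σ with IsPairSorted σ, wedgeTerm α ω v σ := by
  unfold wedgeEval
  refine Finset.sum_congr ?_ fun σ _ => rfl
  ext σ
  simp only [Finset.mem_filter]
  rfl

lemma wedgeTerm_mul_left (v : Fin (2*n+1) → V) (τ σ : Equiv.Perm (Fin (2*n+1))) :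
    wedgeTerm α ω v (τ * σ) = (Equiv.Perm.sign τ : ℤ) • wedgeTerm α ω (v ∘ τ) σ := by
  simp only [wedgeTerm, Equiv.Perm.sign_mul, Units.val_mul, mul_smul, Equiv.Perm.mul_apply,
    Function.comp_apply]

variable {ω} in
lemma wedgeTerm_mul_right (halt : ∀ x, ω x x = 0) (v : Fin (2*n+1) → V)
    {h : Equiv.Perm (Fin (2*n+1))} (hh : h ∈ pairGroup n) :
    ∀ σ, wedgeTerm α ω v (σ * h) = wedgeTerm α ω v σ := by
  induction hh using Subgroup.closure_induction with
  | mem h hmem =>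
    intro σ
    rcases hmem with ⟨i, rfl⟩ | ⟨i, j, hij, rfl⟩
    · have hsign : Equiv.Perm.sign (pairFlip i) = -1 := Equiv.Perm.sign_swap pairFst_ne_pairSnd
      have hprod : ∏ k : Fin n, ω (v ((σ * pairFlip i) (pairFst k)))
            (v ((σ * pairFlip i) (pairSnd k))) =
          -∏ k : Fin n, ω (v (σ (pairFst k))) (v (σ (pairSnd k))) := by
        rw [← Finset.mul_prod_erase _ _ (Finset.mem_univ i),
          ← Finset.mul_prod_erase _ (fun k => ω (v (σ (pairFst k))) (v (σ (pairSnd k))))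
            (Finset.mem_univ i), ← neg_mul]
        congr 1
        · rw [Equiv.Perm.mul_apply, Equiv.Perm.mul_apply, pairFlip_fst_self, pairFlip_snd_self]
          exact (LinearMap.IsAlt.neg (B := ω) halt _ _).symm
        · refine Finset.prod_congr rfl fun k hk => ?_
          have hk := Finset.ne_of_mem_erase hk
          rw [Equiv.Perm.mul_apply, Equiv.Perm.mul_apply, pairFlip_fst_of_ne hk,
            pairFlip_snd_of_ne hk]
      unfold wedgeTerm
      rw [hprod, Equiv.Perm.sign_mul, hsign, Equiv.Perm.mul_apply, pairFlip_zero]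
      simp
    · have hsign : Equiv.Perm.sign (pairExchange i j) = 1 := by
        rw [pairExchange, Equiv.Perm.sign_mul, Equiv.Perm.sign_swap (by simpa using hij),
          Equiv.Perm.sign_swap (by simpa using hij)]
        rfl
      unfold wedgeTerm
      simp only [Equiv.Perm.sign_mul, hsign, mul_one, Equiv.Perm.mul_apply, pairExchange_zero,
        pairExchange_fst, pairExchange_snd]
      rw [Equiv.prod_comp (Equiv.swap i j)
        fun k => ω (v (σ (pairFst k))) (v (σ (pairSnd k)))]
  | one => simp
  | mul g h _ _ hg hh => intro σ; rw [← mul_assoc, hh, hg]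
  | inv h _ hh => intro σ; rw [← hh (σ * h⁻¹), inv_mul_cancel_right]

variable {ω} in
lemma wedgeEval_eq_sum_quotient [Fintype (Equiv.Perm (Fin (2*n+1)) ⧸ pairGroup n)]
    (halt : ∀ x, ω x x = 0) (v : Fin (2*n+1) → V) :
    wedgeEval K n (fun x => α x) (fun x y => ω x y) v =
      ∑ q : Equiv.Perm (Fin (2*n+1)) ⧸ pairGroup n, wedgeTerm α ω v q.out := by
  classical
  rw [wedgeEval_eq_sum_wedgeTerm]
  refine Finset.sum_bij (fun σ _ => (σ : Equiv.Perm (Fin (2*n+1)) ⧸ pairGroup n))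
    (fun _ _ => Finset.mem_univ _) ?_ ?_ ?_
  · intro σ hσ τ hτ hστ
    simp only [Finset.mem_filter, Finset.mem_univ, true_and] at hσ hτ
    have hmem := QuotientGroup.eq.1 hστ
    have := hσ.eq_one_of_mul (h := σ⁻¹ * τ) (by rwa [mul_inv_cancel_left]) hmem
    exact inv_mul_eq_one.1 this
  · intro q _
    obtain ⟨h, hh, hs⟩ := exists_isPairSorted_mul q.out
    refine ⟨q.out * h, by simpa using hs, ?_⟩
    rw [QuotientGroup.mk_mul_of_mem _ hh, QuotientGroup.out_eq']
  · intro σ _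
    obtain ⟨h, hh⟩ := QuotientGroup.mk_out_eq_mul (pairGroup n) σ
    rw [hh, wedgeTerm_mul_right α halt v h.2]

variable {ω} in
lemma wedgeEval_eq_zero_of_eq (h2 : (2 : K) ≠ 0) (halt : ∀ x, ω x x = 0)
    {v : Fin (2*n+1) → V} {k l : Fin (2*n+1)} (hkl : k ≠ l) (hv : v k = v l) :
    wedgeEval K n (fun x => α x) (fun x y => ω x y) v = 0 := by
  classical
  have := Fintype.ofFinite (Equiv.Perm (Fin (2*n+1)) ⧸ pairGroup n)
  rw [wedgeEval_eq_sum_quotient α halt]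
  have hvs : v ∘ Equiv.swap k l = v := by
    ext i
    simp only [Function.comp_apply, Equiv.swap_apply_def]
    split_ifs with h h
    · rw [h, hv]
    · rw [h, hv]
    · rfl
  have hneg : ∀ q : Equiv.Perm (Fin (2*n+1)) ⧸ pairGroup n,
      wedgeTerm α ω v (Equiv.swap k l • q).out = -wedgeTerm α ω v q.out := fun q => by
    have hq : Equiv.swap k l • q =
        ((Equiv.swap k l * q.out : Equiv.Perm _) : Equiv.Perm _ ⧸ pairGroup n) := by
      conv_lhs => rw [← QuotientGroup.out_eq' q]
      rfl
    obtain ⟨h, hh⟩ := QuotientGroup.mk_out_eq_mul (pairGroup n) (Equiv.swap k l * q.out)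
    rw [hq, hh, wedgeTerm_mul_right α halt v h.2, wedgeTerm_mul_left, hvs,
      Equiv.Perm.sign_swap hkl]
    simp
  have hsum := Equiv.sum_comp (MulAction.toPerm (Equiv.swap k l))
    fun q : Equiv.Perm (Fin (2*n+1)) ⧸ pairGroup n => wedgeTerm α ω v q.out
  simp only [MulAction.toPerm_apply, hneg, Finset.sum_neg_distrib] at hsum
  have h2S := neg_eq_iff_add_eq_zero.1 hsum
  rw [← two_mul] at h2S
  exact (mul_eq_zero.1 h2S).resolve_left h2

lemma exists_linearMap_wedgeTerm_update (v : Fin (2*n+1) → V) (k : Fin (2*n+1))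
    (σ : Equiv.Perm (Fin (2*n+1))) :
    ∃ L : V →ₗ[K] K, (∀ u, wedgeTerm α ω (Function.update v k u) σ = L u) ∧
      ∀ u, α u = 0 → (∀ y, ω u y = 0) → (∀ y, ω y u = 0) → L u = 0 := by
  obtain ⟨p, rfl⟩ := σ.surjective k
  have hupd : ∀ u q, q ≠ p → Function.update v (σ p) u (σ q) = v (σ q) := fun u q hq =>
    Function.update_of_ne (σ.injective.ne hq) _ _
  rcases eq_zero_or_pair p with rfl | ⟨i, rfl⟩ | ⟨i, rfl⟩
  · refine ⟨((Equiv.Perm.sign σ : ℤ) •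
      (∏ i : Fin n, ω (v (σ (pairFst i))) (v (σ (pairSnd i))))) • α, fun u => ?_,
      fun u hu _ _ => by simp [hu]⟩
    simp only [wedgeTerm, Function.update_self, hupd _ _ zero_ne_pairFst.symm,
      hupd _ _ zero_ne_pairSnd.symm, LinearMap.smul_apply, smul_eq_mul, zsmul_eq_mul]
    ring
  · refine ⟨((Equiv.Perm.sign σ : ℤ) • (α (v (σ 0)) *
      ∏ j ∈ Finset.univ.erase i, ω (v (σ (pairFst j))) (v (σ (pairSnd j))))) •
        ω.flip (v (σ (pairSnd i))), fun u => ?_, fun u _ hu _ => by simp [hu]⟩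
    rw [wedgeTerm, ← Finset.mul_prod_erase _ _ (Finset.mem_univ i), Finset.prod_congr rfl
      fun j hj => by rw [hupd u (pairFst j) (by simpa using Finset.ne_of_mem_erase hj),
        hupd u (pairSnd j) (by simp)]]
    simp only [Function.update_self, hupd _ _ zero_ne_pairFst,
      hupd _ _ pairSnd_ne_pairFst, LinearMap.smul_apply, smul_eq_mul, zsmul_eq_mul,
      LinearMap.flip_apply]
    ring
  · refine ⟨((Equiv.Perm.sign σ : ℤ) • (α (v (σ 0)) *
      ∏ j ∈ Finset.univ.erase i, ω (v (σ (pairFst j))) (v (σ (pairSnd j))))) •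
        ω (v (σ (pairFst i))), fun u => ?_, fun u _ _ hu => by simp [hu]⟩
    rw [wedgeTerm, ← Finset.mul_prod_erase _ _ (Finset.mem_univ i), Finset.prod_congr rfl
      fun j hj => by rw [hupd u (pairSnd j) (by simpa using Finset.ne_of_mem_erase hj),
        hupd u (pairFst j) (by simp)]]
    simp only [Function.update_self, hupd _ _ zero_ne_pairSnd,
      hupd _ _ pairFst_ne_pairSnd, LinearMap.smul_apply, smul_eq_mul, zsmul_eq_mul]
    ring

lemma exists_linearMap_wedgeEval_update (v : Fin (2*n+1) → V) (k : Fin (2*n+1)) :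
    ∃ L : V →ₗ[K] K,
      (∀ u, wedgeEval K n (fun x => α x) (fun x y => ω x y) (Function.update v k u) = L u) ∧
      ∀ u, α u = 0 → (∀ y, ω u y = 0) → (∀ y, ω y u = 0) → L u = 0 := by
  classical
  choose L hL hL0 using exists_linearMap_wedgeTerm_update α ω v k
  refine ⟨∑ σ with IsPairSorted σ, L σ, fun u => ?_, fun u h1 h2 h3 => ?_⟩
  · rw [wedgeEval_eq_sum_wedgeTerm, LinearMap.sum_apply]
    exact Finset.sum_congr rfl fun σ _ => hL σ u
  · rw [LinearMap.sum_apply]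
    exact Finset.sum_eq_zero fun σ _ => hL0 σ u h1 h2 h3

variable {α ω} in
/-- If `α ∧ ωⁿ ≠ 0`, then `ker α` and the radical of `ω` intersect trivially. -/
lemma eq_zero_of_wedgeEval_ne_zero (h2 : (2 : K) ≠ 0) (hrank : Module.finrank K V = 2*n+1)
    (halt : ∀ x, ω x x = 0) {v : Fin (2*n+1) → V}
    (hv : wedgeEval K n (fun x => α x) (fun x y => ω x y) v ≠ 0)
    {x : V} (hαx : α x = 0) (hωx : ∀ y, ω x y = 0) : x = 0 := by
  have hωx' : ∀ y, ω y x = 0 := fun y => by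
    rw [← LinearMap.IsAlt.neg (B := ω) halt, hωx, neg_zero]
  have key : ∀ c : Fin (2*n+1) → K, α (∑ i, c i • v i) = 0 →
      (∀ y, ω (∑ i, c i • v i) y = 0) → (∀ y, ω y (∑ i, c i • v i) = 0) → ∀ k, c k = 0 := by
    intro c h1 h3 h4 k
    obtain ⟨L, hL, hL0⟩ := exists_linearMap_wedgeEval_update α ω v k
    have h := hL0 _ h1 h3 h4
    rw [map_sum, Finset.sum_eq_single k, map_smul, ← hL, Function.update_eq_self] at h
    · exact (smul_eq_zero.1 h).resolve_right hv
    · intro i _ hi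
      rw [map_smul, ← hL, wedgeEval_eq_zero_of_eq α h2 halt hi, smul_zero]
      rw [Function.update_self, Function.update_of_ne hi]
    · simp
  have hli : LinearIndependent K v := Fintype.linearIndependent_iff.2 fun c hc =>
    key c (by simp [hc]) (by simp [hc]) (by simp [hc])
  have hspan := hli.span_eq_top_of_card_eq_finrank (by simp [hrank])
  obtain ⟨c, rfl⟩ := (Submodule.mem_span_range_iff_exists_fun K).1
    (hspan ▸ Submodule.mem_top : x ∈ Submodule.span K (Set.range v))
  simp [key c hαx hωx hωx']

end wedge

/-- Let `(J,·,α,ω)` be a `(2n+1)`-dimensional cosymplectic JJ-algebra with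
Reeb vector `ξ`.  Then `h = ker α` with `ω_h = ω|_{h×h}` is a `2n`-dimensional symplectic
JJ-algebra, and `D : h → h`, `D(x) = ξ·x`, is an anti-derivation of `(h,·)` with `D² = 0`
and `ω_h(D x, y) = ω_h(x, D y)` on `h`. -/
theorem stmt11 {K V : Type*} [Field K] [AddCommGroup V] [Module K V]
    [FiniteDimensional K V] (h2 : (2 : K) ≠ 0) (h3 : (3 : K) ≠ 0)
    (n : ℕ) (hrank : Module.finrank K V = 2*n+1)
    (m : V →ₗ[K] V →ₗ[K] V)
    (hcomm : ∀ x y, m x y = m y x)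
    (hjac : ∀ x y z, m x (m y z) + m y (m z x) + m z (m x y) = 0)
    (α : V →ₗ[K] K) (ω : V →ₗ[K] V →ₗ[K] K)
    (halt : ∀ x, ω x x = 0)
    (hwedge : ∃ v, wedgeEval K n (fun x => α x) (fun x y => ω x y) v ≠ 0)
    (hαcl : ∀ x y, α (m x y) = 0)
    (hωcl : ∀ x y z, ω (m x y) z + ω (m z x) y + ω (m y z) x = 0)
    (ξ : V) (hξ1 : α ξ = 1) (hξ0 : ∀ y, ω ξ y = 0)
    : (Module.finrank K (LinearMap.ker α) = 2*n) ∧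
      (∀ x y, α x = 0 → α y = 0 → α (m x y) = 0) ∧
      (∀ x, α x = 0 → (∀ y, α y = 0 → ω x y = 0) → x = 0) ∧
      (∀ x y z, α x = 0 → α y = 0 → α z = 0 →
        ω (m x y) z + ω (m z x) y + ω (m y z) x = 0) ∧
      (∀ x, α x = 0 → α (m ξ x) = 0) ∧
      (∀ x y, α x = 0 → α y = 0 →
        m ξ (m x y) = -(m (m ξ x) y) - m x (m ξ y)) ∧
      (∀ x, α x = 0 → m ξ (m ξ x) = 0) ∧
      (∀ x y, α x = 0 → α y = 0 → ω (m ξ x) y = ω x (m ξ y)) := by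
  obtain ⟨v, hv⟩ := hwedge
  have hneg : ∀ x y, ω x y = -ω y x := fun x y =>
    (LinearMap.IsAlt.neg (B := ω) halt y x).symm
  have hξ0' : ∀ y, ω y ξ = 0 := fun y => by rw [hneg, hξ0, neg_zero]
  have hnd : ∀ x, α x = 0 → (∀ y, ω x y = 0) → x = 0 := fun x h1 h2' =>
    eq_zero_of_wedgeEval_ne_zero h2 hrank halt hv h1 h2'
  have hξξ : m ξ ξ = 0 := hnd _ (hαcl _ _) fun z => by
    simpa [hξ0'] using hωcl ξ ξ z
  refine ⟨?_, fun x y _ _ => hαcl x y, ?_, fun x y z _ _ _ => hωcl x y z,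
    fun x _ => hαcl ξ x, ?_, ?_, ?_⟩
  · have hα : α ≠ 0 := fun h => by simp [h] at hξ1
    have := Module.Dual.finrank_ker_add_one_of_ne_zero hα
    omega
  · intro x hx h
    refine hnd x hx fun y => ?_
    simpa [hξ0', hξ1] using h (y - α y • ξ) (by simp [hξ1])
  · intro x y _ _
    have h := hjac ξ x y
    rw [hcomm y ξ, hcomm y (m ξ x)] at h
    rw [eq_sub_iff_add_eq, eq_neg_iff_add_eq_zero]
    exact h
  · intro x _
    have h := hjac ξ ξ x
    rw [hcomm x ξ, hξξ, map_zero, add_zero, ← two_smul K] at h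
    exact (smul_eq_zero.1 h).resolve_left h2
  · intro x y _ _
    have h := hωcl ξ x y
    rw [hξ0', add_zero, hcomm y ξ, hneg (m ξ y) x] at h
    exact add_neg_eq_zero.1 h
end
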